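/- Let F = Fₘ be the free group on m generators, H a complex Hilbert space, n ≥ 1, and Sₙ = {s ∈ F : |s| ≤ n}. Every positive definite function φ : Sₙ → L(H) has a positive definite extension Φ : F → L(H). (Analogue of Krein's extension theorem for free groups.) -/

import Mathlib

open scoped ComplexOrder

/-- A function `φ` (with relevant values on a symmetric subset `S` of the free group) is
*positive definite on `S`* if for every finite family `s₁, …, s_k ∈ S` with
`sᵢ⁻¹sⱼ ∈ S` for all `i, j`, the block operator matrix `[φ(sᵢ⁻¹sⱼ)]` is positive
semidefinite. -/
def IsPosDefOn {m : ℕ} {H : Type*} [NormedAddCommGroup H] [InnerProductSpace ℂ H]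
    (S : Set (FreeGroup (Fin m))) (φ : FreeGroup (Fin m) → H →L[ℂ] H) : Prop :=
  ∀ (k : ℕ) (s : Fin k → FreeGroup (Fin m)), (∀ i, s i ∈ S) →
    (∀ i j, (s i)⁻¹ * s j ∈ S) → ∀ h : Fin k → H,
    0 ≤ ∑ i, ∑ j, (inner ℂ (h i) (φ ((s i)⁻¹ * s j) (h j)) : ℂ)

namespace KreinFree

open ContinuousLinearMap

/-- Contraction intertwining two families with the same Gram matrix. -/
lemma exists_contraction {X H K L : Type*} [NormedAddCommGroup H] [InnerProductSpace ℂ H]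
    [NormedAddCommGroup K] [InnerProductSpace ℂ K] [CompleteSpace K]
    [NormedAddCommGroup L] [InnerProductSpace ℂ L] [CompleteSpace L]
    (α : X → H →L[ℂ] K) (β : X → H →L[ℂ] L)
    (hαβ : ∀ x y h g, (inner ℂ (α x h) (α y g) : ℂ) = inner ℂ (β x h) (β y g)) :
    ∃ T : K →L[ℂ] L, ‖T‖ ≤ 1 ∧ ∀ x h, T (α x h) = β x h := by
  classical
  let A : (X →₀ H) →ₗ[ℂ] K := Finsupp.lsum ℂ (fun x => (α x : H →ₗ[ℂ] K))
  let B : (X →₀ H) →ₗ[ℂ] L := Finsupp.lsum ℂ (fun x => (β x : H →ₗ[ℂ] L))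
  have hin : ∀ f, (inner ℂ (A f) (A f) : ℂ) = inner ℂ (B f) (B f) := by
    intro f
    simp only [A, B, Finsupp.lsum_apply, Finsupp.sum, sum_inner, inner_sum]
    simp [hαβ]
  have hnorm : ∀ f, ‖B f‖ = ‖A f‖ := by
    intro f
    have h1 := hin f
    rw [inner_self_eq_norm_sq_to_K, inner_self_eq_norm_sq_to_K] at h1
    have h2 : ‖A f‖ ^ 2 = ‖B f‖ ^ 2 := by exact_mod_cast h1
    exact ((sq_eq_sq₀ (norm_nonneg _) (norm_nonneg _)).1 h2).symm
  let P : Submodule ℂ K := (LinearMap.range A).topologicalClosure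
  have hP : ∀ f, A f ∈ P := fun f => Submodule.le_topologicalClosure _ ⟨f, rfl⟩
  let e : (X →₀ H) →ₗ[ℂ] P := A.codRestrict P hP
  have hdense : DenseRange e := by
    intro y
    rw [closure_subtype]
    have h1 : ((↑) '' (Set.range e) : Set K) = (LinearMap.range A : Set K) := by
      ext z
      simp [e]
    rw [h1]
    exact y.2
  have hle : ∀ f, ‖B f‖ ≤ 1 * ‖e f‖ := by
    intro f
    rw [hnorm, one_mul]
    exact le_rfl
  have : CompleteSpace P := (Submodule.isClosed_topologicalClosure _).completeSpace_coe
  let T0 : P →L[ℂ] L := B.extendOfNorm e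
  have hT0 : ‖T0‖ ≤ 1 := LinearMap.opNorm_extendOfNorm_le hdense zero_le_one hle
  refine ⟨T0 ∘L P.orthogonalProjectionOnto, ?_, ?_⟩
  · refine (opNorm_comp_le _ _).trans ?_
    exact mul_le_one₀ hT0 (norm_nonneg _) (P.orthogonalProjectionOnto_norm_le)
  · intro x h
    have h1 : α x h = (e (Finsupp.single x h) : K) := by
      simp [e, A]
    rw [h1, comp_apply, Submodule.orthogonalProjectionOnto_mem_subspace_eq_self]
    rw [LinearMap.extendOfNorm_eq hdense ⟨1, hle⟩]
    simp [B]

/-- Unitary dilation of a contraction on the doubled space. -/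
lemma exists_unitary_dilation {K : Type*} [NormedAddCommGroup K] [InnerProductSpace ℂ K]
    [CompleteSpace K] (T : K →L[ℂ] K) (hT : ‖T‖ ≤ 1) :
    ∃ U : unitary (WithLp 2 (K × K) →L[ℂ] WithLp 2 (K × K)), ∀ x y : K,
      (inner ℂ (WithLp.toLp 2 (y, (0 : K))) ((U : WithLp 2 (K × K) →L[ℂ] WithLp 2 (K × K))
        (WithLp.toLp 2 (x, (0 : K)))) : ℂ) = inner ℂ y (T x) := by
  let Eq := WithLp.prodContinuousLinearEquiv 2 ℂ K K
  let mk : ((K × K) →L[ℂ] (K × K)) → (WithLp 2 (K × K) →L[ℂ] WithLp 2 (K × K)) := fun M =>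
    (Eq.symm : (K × K) →L[ℂ] WithLp 2 (K × K)) ∘L M ∘L (Eq : WithLp 2 (K × K) →L[ℂ] (K × K))
  let S : WithLp 2 (K × K) →L[ℂ] WithLp 2 (K × K) := mk ((adjoint T ∘L snd ℂ K K).prod (T ∘L fst ℂ K K))
  let W : WithLp 2 (K × K) →L[ℂ] WithLp 2 (K × K) := mk ((snd ℂ K K).prod (fst ℂ K K))
  let J : WithLp 2 (K × K) →L[ℂ] WithLp 2 (K × K) := mk ((fst ℂ K K).prod (-(snd ℂ K K)))
  have hS : ∀ x : WithLp 2 (K × K), S x = WithLp.toLp 2 (adjoint T x.snd, T x.fst) := fun x => rfl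
  have hW : ∀ x : WithLp 2 (K × K), W x = WithLp.toLp 2 (x.snd, x.fst) := fun x => rfl
  have hJ : ∀ x : WithLp 2 (K × K), J x = WithLp.toLp 2 (x.fst, -x.snd) := fun x => rfl
  have hSsa : IsSelfAdjoint S := by
    rw [isSelfAdjoint_iff_isSymmetric]
    intro x y
    simp [hS, WithLp.prod_inner_apply, adjoint_inner_left, adjoint_inner_right, add_comm]
  have hSn : ‖S‖ ≤ 1 := by
    refine opNorm_le_bound _ zero_le_one fun x => ?_
    rw [one_mul, ← sq_le_sq₀ (norm_nonneg _) (norm_nonneg _), hS,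
      WithLp.prod_norm_sq_eq_of_L2, WithLp.prod_norm_sq_eq_of_L2]
    have h1 : ‖adjoint T x.snd‖ ≤ ‖x.snd‖ := by
      refine (le_opNorm _ _).trans ?_
      rw [LinearIsometryEquiv.norm_map]
      exact mul_le_of_le_one_left (norm_nonneg _) hT
    have h2 : ‖T x.fst‖ ≤ ‖x.fst‖ :=
      (le_opNorm _ _).trans (mul_le_of_le_one_left (norm_nonneg _) hT)
    have h3 := pow_le_pow_left₀ (norm_nonneg _) h1 2
    have h4 := pow_le_pow_left₀ (norm_nonneg _) h2 2
    change ‖adjoint T x.snd‖ ^ 2 + ‖T x.fst‖ ^ 2 ≤ _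
    linarith
  have hWu : W ∈ unitary (WithLp 2 (K × K) →L[ℂ] WithLp 2 (K × K)) := by
    have hWs : star W = W := by
      change IsSelfAdjoint W
      rw [isSelfAdjoint_iff_isSymmetric]
      intro x y
      simp [hW, add_comm]
    have hWW : W * W = 1 := by
      ext x : 1
      simp [hW]
      rfl
    rw [Unitary.mem_iff, hWs]
    exact ⟨hWW, hWW⟩
  have hcomm : Commute J (CFC.sqrt (1 - S ^ 2)) := by
    have h1 : Commute (1 - S ^ 2) J := by
      refine (Commute.one_left _).sub_left ?_
      rw [commute_iff_eq]
      ext x : 1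
      simp [pow_two, hS, hJ]
    exact (h1.cfcₙ_nnreal _).symm
  refine ⟨⟨W, hWu⟩ * ⟨_, hSsa.self_add_I_smul_cfcSqrt_sub_sq_mem_unitary S hSn⟩, fun x y => ?_⟩
  set D := CFC.sqrt (1 - S ^ 2) with hD
  have hDz : (D (WithLp.toLp 2 (x, (0 : K)))).snd = 0 := by
    have h1 := congrArg (fun M : WithLp 2 (K × K) →L[ℂ] WithLp 2 (K × K) => M (WithLp.toLp 2 (x, (0 : K)))) hcomm.eq
    change J (D (WithLp.toLp 2 (x, (0 : K)))) = D (J (WithLp.toLp 2 (x, (0 : K)))) at h1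
    have h0 : J (WithLp.toLp 2 (x, (0 : K))) = WithLp.toLp 2 (x, (0 : K)) := by simp [hJ]
    rw [h0, hJ] at h1
    have h2 := congrArg (fun z : WithLp 2 (K × K) => z.snd) h1
    change -(D (WithLp.toLp 2 (x, (0 : K)))).snd = (D (WithLp.toLp 2 (x, (0 : K)))).snd at h2
    have h3 : (2 : ℂ) • (D (WithLp.toLp 2 (x, (0 : K)))).snd = 0 := by
      rw [two_smul]
      nth_rewrite 1 [← h2]
      exact neg_add_cancel _
    exact (smul_eq_zero.1 h3).resolve_left two_ne_zero
  rw [hD] at hDz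
  simp [hW, hS, hDz]

end KreinFree

universe u

namespace KreinFree

open ContinuousLinearMap

/-- Hermitian symmetry. -/
lemma herm {m n : ℕ} {H : Type*} [NormedAddCommGroup H] [InnerProductSpace ℂ H]
    {φ : FreeGroup (Fin m) → H →L[ℂ] H}
    (hφ : IsPosDefOn {s : FreeGroup (Fin m) | FreeGroup.norm s ≤ n} φ)
    (s : FreeGroup (Fin m)) (hs : FreeGroup.norm s ≤ n) (h g : H) :
    (inner ℂ h (φ s g) : ℂ) = (starRingEnd ℂ) (inner ℂ g (φ s⁻¹ h)) := by
  have h1 : ∀ h : H, (inner ℂ h (φ 1 h) : ℂ).im = 0 := by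
    intro h
    have h2 := hφ 1 (fun _ => 1) (by simp) (by simp) (fun _ => h)
    simp only [Fin.sum_univ_one, inv_one, mul_one] at h2
    exact ((Complex.le_def.1 h2).2).symm
  have h2 : ∀ h g : H, (inner ℂ h (φ s g) + inner ℂ g (φ s⁻¹ h) : ℂ).im = 0 := by
    intro h g
    have h3 := hφ 2 ![1, s] (by intro i; fin_cases i <;> simp [hs])
      (by intro i j; fin_cases i <;> fin_cases j <;> simp [hs, FreeGroup.norm_inv_eq]) ![h, g]
    simp only [Fin.sum_univ_two, Matrix.cons_val_zero, Matrix.cons_val_one, inv_one, one_mul,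
      mul_one, inv_mul_cancel] at h3
    have h4 := (Complex.le_def.1 h3).2
    have h5 := h1 h
    have h6 := h1 g
    simp only [Complex.add_im, Complex.zero_im] at h4 ⊢
    linarith
  have h3 := h2 h g
  have h4 := h2 h (Complex.I • g)
  simp only [map_smul, inner_smul_left, inner_smul_right, Complex.add_im, Complex.mul_im,
    Complex.conj_I, Complex.I_re, Complex.I_im, Complex.neg_re, Complex.neg_im] at h3 h4
  apply Complex.ext
  · simp only [Complex.conj_re]
    linarith
  · simp only [Complex.conj_im]
    linarith

/-- The Kolmogorov decomposition on a clique `C`. -/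
lemma exists_gns {m n : ℕ} {H : Type u} [NormedAddCommGroup H] [InnerProductSpace ℂ H]
    [CompleteSpace H]
    {φ : FreeGroup (Fin m) → H →L[ℂ] H}
    (hφ : IsPosDefOn {s : FreeGroup (Fin m) | FreeGroup.norm s ≤ n} φ)
    (C : Set (FreeGroup (Fin m))) (hC : ∀ s ∈ C, FreeGroup.norm s ≤ n)
    (hCC : ∀ s ∈ C, ∀ t ∈ C, FreeGroup.norm (s⁻¹ * t) ≤ n) :
    ∃ (K : Type u) (_ : NormedAddCommGroup K) (_ : InnerProductSpace ℂ K) (_ : CompleteSpace K)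
      (δ : FreeGroup (Fin m) → H →L[ℂ] K), ∀ s ∈ C, ∀ t ∈ C, ∀ h g : H,
      (inner ℂ (δ s h) (δ t g) : ℂ) = inner ℂ h (φ (s⁻¹ * t) g) := by
  classical
  let M : Matrix C C (H →L[ℂ] H) := Matrix.of fun s t => φ ((s : FreeGroup (Fin m))⁻¹ * t)
  have hM : ∀ s t : C, M s t = φ ((s : FreeGroup (Fin m))⁻¹ * t) := fun _ _ => rfl
  have hherm : M.IsHermitian := by
    ext s t : 1
    rw [Matrix.conjTranspose_apply, star_eq_adjoint, hM, hM]
    symm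
    rw [eq_adjoint_iff]
    intro x y
    rw [← inner_conj_symm, herm hφ _ (hCC _ s.2 _ t.2)]
    simp
  have hpos : M.PosSemidef := by
    have htf := (RKHS.posSemidef_tfae (K := M)).out 0 2
    refine htf.mpr ⟨hherm, fun vv => ?_⟩
    let e := vv.support.equivFin
    have h1 := hφ vv.support.card (fun i => ((e.symm i : C) : FreeGroup (Fin m)))
      (fun i => hC _ (e.symm i : C).2) (fun i j => hCC _ (e.symm i : C).2 _ (e.symm j : C).2)
      (fun i => vv (e.symm i))
    have h2 : (vv.sum fun x w => vv.sum fun x' w' => (inner ℂ (M x' x w) w' : ℂ)) =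
        ∑ i, ∑ j, (inner ℂ (vv (e.symm i))
          (φ (((e.symm i : C) : FreeGroup (Fin m))⁻¹ * ((e.symm j : C) : FreeGroup (Fin m)))
            (vv (e.symm j))) : ℂ) := by
      rw [Equiv.sum_comp e.symm (fun a => ∑ j, (inner ℂ (vv a)
          (φ (((a : C) : FreeGroup (Fin m))⁻¹ * ((e.symm j : C) : FreeGroup (Fin m)))
            (vv (e.symm j))) : ℂ))]
      have h3 : ∀ a : vv.support, (∑ j, (inner ℂ (vv a)
          (φ (((a : C) : FreeGroup (Fin m))⁻¹ * ((e.symm j : C) : FreeGroup (Fin m)))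
            (vv (e.symm j))) : ℂ)) = ∑ b : vv.support, (inner ℂ (vv a)
          (φ (((a : C) : FreeGroup (Fin m))⁻¹ * ((b : C) : FreeGroup (Fin m)))
            (vv b)) : ℂ) := fun a => Equiv.sum_comp e.symm (fun b : vv.support => (inner ℂ (vv a)
          (φ (((a : C) : FreeGroup (Fin m))⁻¹ * ((b : C) : FreeGroup (Fin m)))
            (vv b)) : ℂ))
      simp only [h3]
      simp only [Finsupp.sum]
      rw [← Finset.sum_coe_sort vv.support]
      refine Finset.sum_congr rfl fun a _ => ?_
      rw [← Finset.sum_coe_sort vv.support]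
      refine Finset.sum_congr rfl fun b _ => ?_
      rw [hM, ← inner_conj_symm, herm hφ _ (hCC _ b.1.2 _ a.1.2)]
      simp
    rw [h2]
    exact (Complex.le_def.1 h1).1
  have : Fact M.PosSemidef := ⟨hpos⟩
  refine ⟨RKHS.OfKernel M, inferInstance, inferInstance, inferInstance,
    fun s => if hs : s ∈ C then RKHS.kerFun (RKHS.OfKernel M) (⟨s, hs⟩ : C) else 0,
    fun s hs t ht h g => ?_⟩
  simp only [dif_pos hs, dif_pos ht]
  have hk := congrFun (congrFun (RKHS.OfKernel.kernel_ofKernel (K := M)) ⟨s, hs⟩) ⟨t, ht⟩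
  rw [RKHS.kernel_apply, hM] at hk
  have hk' := congrArg (fun N : H →L[ℂ] H => (inner ℂ h (N g) : ℂ)) hk
  simp only [comp_apply, adjoint_inner_right] at hk'
  exact hk'

end KreinFree

namespace KreinFree

open ContinuousLinearMap

/-- The compression of the generator `a`, a contraction on the space of the ball. -/
lemma exists_T {m n : ℕ} {H : Type u} [NormedAddCommGroup H] [InnerProductSpace ℂ H]
    [CompleteSpace H]
    {φ : FreeGroup (Fin m) → H →L[ℂ] H}
    (hφ : IsPosDefOn {s : FreeGroup (Fin m) | FreeGroup.norm s ≤ n} φ)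
    (r : ℕ) (hr : 2 * r ≤ n)
    {K : Type u} [NormedAddCommGroup K] [InnerProductSpace ℂ K] [CompleteSpace K]
    (δ : FreeGroup (Fin m) → H →L[ℂ] K)
    (hδ : ∀ s t, FreeGroup.norm s ≤ r → FreeGroup.norm t ≤ r → ∀ h g : H,
      (inner ℂ (δ s h) (δ t g) : ℂ) = inner ℂ h (φ (s⁻¹ * t) g))
    (a : FreeGroup (Fin m)) :
    ∃ T : K →L[ℂ] K, ‖T‖ ≤ 1 ∧ ∀ s t, FreeGroup.norm s ≤ r → FreeGroup.norm t ≤ r →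
      FreeGroup.norm (a * s) ≤ n - r → ∀ h g : H,
      (inner ℂ (δ t g) (T (δ s h)) : ℂ) = inner ℂ g (φ (t⁻¹ * (a * s)) h) := by
  let A : Set (FreeGroup (Fin m)) := {s | FreeGroup.norm s ≤ r ∧ FreeGroup.norm (a * s) ≤ n - r}
  let B : Set (FreeGroup (Fin m)) := {s | FreeGroup.norm s ≤ r}
  let C : Set (FreeGroup (Fin m)) := {s | s ∈ B ∨ a⁻¹ * s ∈ A}
  have hBC : ∀ s ∈ B, s ∈ C := fun s hs => Or.inl hs
  have hAC : ∀ s ∈ A, a * s ∈ C := fun s hs => Or.inr (by simpa using hs)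
  have hle : ∀ s t : FreeGroup (Fin m), FreeGroup.norm (s⁻¹ * t) ≤
      FreeGroup.norm s + FreeGroup.norm t := by
    intro s t
    refine (FreeGroup.norm_mul_le _ _).trans ?_
    rw [FreeGroup.norm_inv_eq]
  have hC : ∀ s ∈ C, FreeGroup.norm s ≤ n := by
    rintro s (hs | hs)
    · have h1 : FreeGroup.norm s ≤ r := hs
      omega
    · have h1 := hs.2
      rw [mul_inv_cancel_left] at h1
      omega
  have hCC : ∀ s ∈ C, ∀ t ∈ C, FreeGroup.norm (s⁻¹ * t) ≤ n := by
    rintro s (hs | hs) t (ht | ht)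
    · have h1 : FreeGroup.norm s ≤ r := hs
      have h2 : FreeGroup.norm t ≤ r := ht
      have := hle s t
      omega
    · have h1 : FreeGroup.norm s ≤ r := hs
      have h2 := ht.2
      rw [mul_inv_cancel_left] at h2
      have := hle s t
      omega
    · have h1 : FreeGroup.norm t ≤ r := ht
      have h2 := hs.2
      rw [mul_inv_cancel_left] at h2
      have := hle s t
      omega
    · have h1 := hs.1
      have h2 := ht.1
      have h3 := hle (a⁻¹ * s) (a⁻¹ * t)
      have h4 : (a⁻¹ * s)⁻¹ * (a⁻¹ * t) = s⁻¹ * t := by group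
      rw [h4] at h3
      omega
  obtain ⟨L, _, _, _, ε, hε⟩ := exists_gns hφ C hC hCC
  obtain ⟨T1, hT1, hT1'⟩ := exists_contraction (fun s : B => δ s) (fun s : B => ε s) (by
    intro s t h g
    rw [hδ _ _ s.2 t.2, hε _ (hBC _ s.2) _ (hBC _ t.2)])
  obtain ⟨T2, hT2, hT2'⟩ := exists_contraction (fun s : A => δ s) (fun s : A => ε (a * s)) (by
    intro s t h g
    rw [hδ _ _ s.2.1 t.2.1, hε _ (hAC _ s.2) _ (hAC _ t.2)]
    congr 3
    group)
  refine ⟨adjoint T1 ∘L T2, ?_, ?_⟩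
  · refine (opNorm_comp_le _ _).trans ?_
    rw [LinearIsometryEquiv.norm_map]
    exact mul_le_one₀ hT1 (norm_nonneg _) hT2
  · intro s t hs ht has h g
    have h1 := hT1' ⟨t, ht⟩ g
    have h2 := hT2' ⟨s, hs, has⟩ h
    simp only at h1 h2
    rw [comp_apply, adjoint_inner_right, h1, h2, hε _ (hBC _ ht) _ (hAC _ ⟨hs, has⟩)]

/-- Peeling off the first letters of a reduced word. -/
lemma exists_split {m : ℕ} (s : FreeGroup (Fin m)) (p q : ℕ) (h : FreeGroup.norm s ≤ p + q) :
    ∃ u w, s = u⁻¹ * w ∧ FreeGroup.norm u ≤ p ∧ FreeGroup.norm w ≤ q := by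
  refine ⟨(FreeGroup.mk (s.toWord.take p))⁻¹, FreeGroup.mk (s.toWord.drop p), ?_, ?_, ?_⟩
  · rw [inv_inv, FreeGroup.mul_mk, List.take_append_drop, FreeGroup.mk_toWord]
  · rw [FreeGroup.norm_inv_eq]
    refine FreeGroup.norm_mk_le.trans ?_
    simp
  · refine FreeGroup.norm_mk_le.trans ?_
    have h1 : s.toWord.length ≤ p + q := h
    simp
    omega

lemma exists_letter {m : ℕ} (s : FreeGroup (Fin m)) (q : ℕ) (h : FreeGroup.norm s ≤ q + 1) :
    FreeGroup.norm s ≤ q ∨ ∃ (k : Fin m) (v : FreeGroup (Fin m)), FreeGroup.norm v ≤ q ∧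
      (s = FreeGroup.of k * v ∨ s = (FreeGroup.of k)⁻¹ * v) := by
  rcases hw : s.toWord with _ | ⟨⟨k, b⟩, l⟩
  · left
    simp [FreeGroup.norm, hw]
  · right
    have hs : s = FreeGroup.mk [(k, b)] * FreeGroup.mk l := by
      rw [FreeGroup.mul_mk, List.singleton_append, ← hw, FreeGroup.mk_toWord]
    have hl : l.length ≤ q := by
      have h1 : s.toWord.length ≤ q + 1 := h
      rw [hw] at h1
      simpa using h1
    refine ⟨k, FreeGroup.mk l, FreeGroup.norm_mk_le.trans hl, ?_⟩
    cases b
    · right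
      rw [hs]
      rfl
    · left
      rw [hs]
      rfl

end KreinFree

/-- Krein-type extension theorem for free groups. Every positive
definite `L(H)`-valued function on `Sₙ = {s : |s| ≤ n}` extends to a positive definite
function on all of `F = Fₘ`. -/
theorem posDef_extension_of_ball {m n : ℕ} (hn : 1 ≤ n)
    {H : Type*} [NormedAddCommGroup H] [InnerProductSpace ℂ H] [CompleteSpace H]
    (φ : FreeGroup (Fin m) → H →L[ℂ] H)
    (hφ : IsPosDefOn {s : FreeGroup (Fin m) | FreeGroup.norm s ≤ n} φ) :
    ∃ Φ : FreeGroup (Fin m) → H →L[ℂ] H,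
      IsPosDefOn (Set.univ : Set (FreeGroup (Fin m))) Φ ∧
      Set.EqOn Φ φ {s : FreeGroup (Fin m) | FreeGroup.norm s ≤ n} := by
  classical
  obtain ⟨r, hr, hr'⟩ : ∃ r, 2 * r ≤ n ∧ n ≤ 2 * r + 1 := ⟨n / 2, by omega, by omega⟩
  have hle : ∀ s t : FreeGroup (Fin m), FreeGroup.norm (s⁻¹ * t) ≤
      FreeGroup.norm s + FreeGroup.norm t := by
    intro s t
    refine (FreeGroup.norm_mul_le _ _).trans ?_
    rw [FreeGroup.norm_inv_eq]
  obtain ⟨K, _, _, _, δ, hδ⟩ := KreinFree.exists_gns hφ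
    {s : FreeGroup (Fin m) | FreeGroup.norm s ≤ r}
    (fun s hs => by
      have h1 : FreeGroup.norm s ≤ r := hs
      omega)
    (fun s hs t ht => by
      have h1 : FreeGroup.norm s ≤ r := hs
      have h2 : FreeGroup.norm t ≤ r := ht
      have := hle s t
      omega)
  have hδ' : ∀ s t, FreeGroup.norm s ≤ r → FreeGroup.norm t ≤ r → ∀ h g : H,
      (inner ℂ (δ s h) (δ t g) : ℂ) = inner ℂ h (φ (s⁻¹ * t) g) :=
    fun s t hs ht => hδ s hs t ht
  have hT := fun k : Fin m => KreinFree.exists_T hφ r hr δ hδ' (FreeGroup.of k)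
  choose T hT1 hT2 using hT
  have hU := fun k : Fin m => KreinFree.exists_unitary_dilation (T k) (hT1 k)
  choose U hU using hU
  let ι : K →L[ℂ] WithLp 2 (K × K) :=
    ((WithLp.prodContinuousLinearEquiv 2 ℂ K K).symm : (K × K) →L[ℂ] WithLp 2 (K × K)) ∘L
      (ContinuousLinearMap.inl ℂ K K)
  have hι : ∀ x, ι x = WithLp.toLp 2 (x, (0 : K)) := fun x => rfl
  obtain ⟨d, hd⟩ : ∃ d : FreeGroup (Fin m) → H →L[ℂ] WithLp 2 (K × K),
    ∀ s h, d s h = WithLp.toLp 2 (δ s h, (0 : K)) := ⟨fun s => ι ∘L δ s, fun s h => rfl⟩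
  have hdd : ∀ s t, FreeGroup.norm s ≤ r → FreeGroup.norm t ≤ r → ∀ h g : H,
      (inner ℂ (d s h) (d t g) : ℂ) = inner ℂ h (φ (s⁻¹ * t) g) := by
    intro s t hs ht h g
    rw [hd, hd, ← hδ' s t hs ht]
    simp
  have hdU : ∀ k s t, FreeGroup.norm s ≤ r → FreeGroup.norm t ≤ r →
      FreeGroup.norm (FreeGroup.of k * s) ≤ n - r → ∀ h g : H,
      (inner ℂ (d t g) ((U k : WithLp 2 (K × K) →L[ℂ] WithLp 2 (K × K)) (d s h)) : ℂ) =
        inner ℂ g (φ (t⁻¹ * (FreeGroup.of k * s)) h) := by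
    intro k s t hs ht hks h g
    rw [hd, hd, hU, hT2 k s t hs ht hks]
  let π : FreeGroup (Fin m) →* unitary (WithLp 2 (K × K) →L[ℂ] WithLp 2 (K × K)) :=
    FreeGroup.lift U
  let P : FreeGroup (Fin m) → (WithLp 2 (K × K) →L[ℂ] WithLp 2 (K × K)) := fun s => (π s : _)
  have hPof : ∀ k, P (FreeGroup.of k) = U k := by
    intro k
    simp [P, π]
  have hPmul : ∀ s t x, P (s * t) x = P s (P t x) := by
    intro s t x
    simp [P]
  have hPone : ∀ x, P 1 x = x := by
    intro x
    simp [P]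
  have hPinv : ∀ s x y, (inner ℂ x (P s⁻¹ y) : ℂ) = inner ℂ (P s x) y := by
    intro s x y
    have h1 : P s⁻¹ = ContinuousLinearMap.adjoint (P s) := by
      simp only [P, map_inv]
      rfl
    rw [h1, ContinuousLinearMap.adjoint_inner_right]
  have hPinner : ∀ s x y, (inner ℂ (P s x) (P s y) : ℂ) = inner ℂ x y := by
    intro s x y
    rw [← hPinv, ← hPmul, inv_mul_cancel, hPone]
  -- one generator acts as it should
  have hstep : ∀ k v, FreeGroup.norm v ≤ r → FreeGroup.norm (FreeGroup.of k * v) ≤ r →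
      ∀ h, P (FreeGroup.of k) (d v h) = d (FreeGroup.of k * v) h := by
    intro k v hv hkv h
    rw [← sub_eq_zero, ← inner_self_eq_zero (𝕜 := ℂ)]
    have e1 := hPinner (FreeGroup.of k) (d v h) (d v h)
    rw [hdd v v hv hv] at e1
    have e2 := hdU k v (FreeGroup.of k * v) hv hkv (by omega) h h
    rw [← hPof] at e2
    have e3 := hdd _ _ hkv hkv h h
    have e4 : (inner ℂ (P (FreeGroup.of k) (d v h)) (d (FreeGroup.of k * v) h) : ℂ) =
        inner ℂ h (φ 1 h) := by
      rw [← inner_conj_symm, e2, KreinFree.herm hφ]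
      · simp
      · simp
    simp only [inv_mul_cancel] at e1 e2 e3
    rw [inner_sub_left, inner_sub_right, inner_sub_right, e1, e2, e3, e4]
    ring
  have hball : ∀ q, q ≤ r → ∀ v, FreeGroup.norm v ≤ q → ∀ h, P v (d 1 h) = d v h := by
    intro q
    induction q with
    | zero =>
      intro _ v hv h
      have h1 : v = 1 := FreeGroup.norm_eq_zero.1 (by omega)
      rw [h1, hPone]
    | succ q ih =>
      intro hq v hv h
      rcases KreinFree.exists_letter v q hv with h1 | ⟨k, w, hw, rfl | rfl⟩
      · exact ih (by omega) v h1 h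
      · rw [hPmul, ih (by omega) w hw, hstep k w (by omega) (by omega)]
      · rw [hPmul, ih (by omega) w hw]
        have h1 := hstep k ((FreeGroup.of k)⁻¹ * w) (by omega)
          (by rw [mul_inv_cancel_left]; omega) h
        rw [mul_inv_cancel_left] at h1
        rw [← h1, ← hPmul, inv_mul_cancel, hPone]
  refine ⟨fun s => ContinuousLinearMap.adjoint (d 1) ∘L P s ∘L d 1, ?_, ?_⟩
  · intro k s _ _ h
    have h1 : (∑ i, ∑ j, (inner ℂ (h i) ((ContinuousLinearMap.adjoint (d 1) ∘L
        P ((s i)⁻¹ * s j) ∘L d 1) (h j)) : ℂ)) =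
        inner ℂ (∑ i, P (s i) (d 1 (h i))) (∑ i, P (s i) (d 1 (h i))) := by
      rw [sum_inner]
      refine Finset.sum_congr rfl fun i _ => ?_
      rw [inner_sum]
      refine Finset.sum_congr rfl fun j _ => ?_
      rw [ContinuousLinearMap.comp_apply, ContinuousLinearMap.adjoint_inner_right,
        ContinuousLinearMap.comp_apply, hPmul, hPinv]
    rw [h1, inner_self_eq_norm_sq_to_K]
    have h2 : (0 : ℝ) ≤ ‖∑ i, P (s i) (d 1 (h i))‖ ^ 2 := by positivity
    have h3 := Complex.zero_le_real.2 h2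
    rw [Complex.ofReal_pow] at h3
    exact h3
  · intro s hs
    have hs' : FreeGroup.norm s ≤ n := hs
    ext g : 1
    refine ext_inner_left ℂ fun h => ?_
    rw [ContinuousLinearMap.comp_apply, ContinuousLinearMap.adjoint_inner_right,
        ContinuousLinearMap.comp_apply]
    obtain ⟨u, w, rfl, hu, hw⟩ := KreinFree.exists_split s r (n - r) (by omega)
    rw [hPmul, hPinv, hball r le_rfl u hu]
    rcases KreinFree.exists_letter w r (by omega) with h1 | ⟨k, v, hv, rfl | rfl⟩
    · rw [hball r le_rfl w h1, hdd u w hu h1]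
    · rw [hPmul, hball r le_rfl v hv, hPof, hdU k v u hv hu hw]
    · rw [hPmul, hball r le_rfl v hv, hPinv]
      by_cases hku : FreeGroup.norm (FreeGroup.of k * u) ≤ n - r
      · rw [← inner_conj_symm, hPof, hdU k u v hu hv hku, KreinFree.herm hφ _ hs']
        congr 3
        group
      · -- then `n` is even
        have h2 : FreeGroup.norm ((FreeGroup.of k)⁻¹ * v) ≤ r := by
          by_contra h3
          have h4 := FreeGroup.norm_mul_le (FreeGroup.of k) u
          rw [FreeGroup.norm_of] at h4
          omega
        rw [← hPinv, ← hball r le_rfl v hv, ← hPmul, hball r le_rfl _ h2, hdd _ _ hu h2]
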